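/- Baseline Shapley preserves first-order monotonic dominance: let f : ℝ × (Fin p → ℝ) × (Fin q → ℝ) → ℝ and g : ℝ × (Fin p → ℝ) × (Fin r → ℝ) → ℝ be smooth, and suppose that for all a ∈ ℝ, all shared coordinates b ∈ (Fin p → ℝ), and all u ∈ (Fin q → ℝ), w ∈ (Fin r → ℝ), one has ∂f/∂a(a, b, u) ≥ ∂g/∂a(a, b, w) (f dominates g in the first coordinate at first order). Then for explicands x̄ = (ā, b̄, ū) and ȳ = (ā, b̄, w̄) with the same first coordinate and shared coordinates, and baselines x' = (a', b', u') and y' = (a', b', w') with the same first coordinate and shared coordinates, where ā ≥ a', the Baseline Shapley attribution of the first coordinate satisfies BS_a(x̄, x', f) ≥ BS_a(ȳ, y', g). -/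

import Mathlib

open Finset

/-- Baseline Shapley attribution on an arbitrary finite coordinate set `ι`:
`v(S) = F(x̄_S ; x'_{N∖S})`. -/
noncomputable def BShap {ι : Type} [Fintype ι] [DecidableEq ι]
    (xbar x' : ι → ℝ) (F : (ι → ℝ) → ℝ) (i : ι) : ℝ :=
  ∑ S ∈ (Finset.univ.erase i).powerset,
    ((S.card.factorial * (Fintype.card ι - S.card - 1).factorial : ℝ) /
        ((Fintype.card ι).factorial : ℝ)) *
      (F (fun j => if j ∈ insert i S then xbar j else x' j) -
       F (fun j => if j ∈ S then xbar j else x' j))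

/-- Repackage a vector indexed by `Unit ⊕ Fin p ⊕ Fin q` as a point of
`ℝ × (Fin p → ℝ) × (Fin q → ℝ)`. -/
def pack {p q : ℕ} (z : (Unit ⊕ Fin p ⊕ Fin q) → ℝ) : ℝ × (Fin p → ℝ) × (Fin q → ℝ) :=
  (z (Sum.inl ()), fun j => z (Sum.inr (Sum.inl j)), fun j => z (Sum.inr (Sum.inr j)))

/-- The vector indexed by `Unit ⊕ Fin p ⊕ Fin q` corresponding to `(a, b, u)`. -/
def unpack {p q : ℕ} (a : ℝ) (b : Fin p → ℝ) (u : Fin q → ℝ) : (Unit ⊕ Fin p ⊕ Fin q) → ℝ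
  | Sum.inl _ => a
  | Sum.inr (Sum.inl j) => b j
  | Sum.inr (Sum.inr j) => u j

/-- The Shapley weight of a coalition of size `s` among `n` players. -/
noncomputable def shapleyWeight (s n : ℕ) : ℝ :=
  (s.factorial * (n - s - 1).factorial : ℝ) / (n.factorial : ℝ)

lemma shapleyWeight_nonneg (s n : ℕ) : 0 ≤ shapleyWeight s n := by
  unfold shapleyWeight
  positivity

lemma shapleyWeight_add_succ {s n : ℕ} (h : s < n) :
    shapleyWeight s (n + 1) + shapleyWeight (s + 1) (n + 1) = shapleyWeight s n := by
  obtain ⟨k, rfl⟩ := Nat.exists_eq_add_of_lt h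
  unfold shapleyWeight
  rw [show s + k + 1 + 1 - s - 1 = k + 1 by omega, show s + k + 1 + 1 - (s + 1) - 1 = k by omega,
    show s + k + 1 - s - 1 = k by omega, Nat.factorial_succ (s + k + 1), Nat.factorial_succ k,
    Nat.factorial_succ s]
  have h₁ : ((s + k + 1).factorial : ℝ) ≠ 0 := by positivity
  have h₂ : (s + k + 1 + 1 : ℝ) ≠ 0 := by positivity
  push_cast
  field_simp
  ring

/-- Summing out the players of `B` turns Shapley weights for `n + #B` players into Shapley
weights for `n` players. -/
lemma sum_powerset_shapleyWeight {α : Type*} [DecidableEq α] {s n : ℕ} (h : s < n)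
    (B : Finset α) :
    ∑ T ∈ B.powerset, shapleyWeight (s + T.card) (n + B.card) = shapleyWeight s n := by
  induction B using Finset.induction_on with
  | empty => simp
  | insert a B ha ih =>
    rw [Finset.sum_powerset_insert ha, ← Finset.sum_add_distrib, ← ih]
    refine Finset.sum_congr rfl fun T hT => ?_
    have hTB := Finset.mem_powerset.mp hT
    have hcard := Finset.card_le_card hTB
    rw [Finset.card_insert_of_notMem ha, Finset.card_insert_of_notMem fun hh => ha (hTB hh),
      ← add_assoc, ← add_assoc]
    exact shapleyWeight_add_succ (by omega)

/-- The marginal contribution of the first coordinate to the coalition `A ∪ B`, where `A` consists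
of shared and `B` of private coordinates. -/
def marginal {p q : ℕ} (f : ℝ × (Fin p → ℝ) × (Fin q → ℝ) → ℝ) (abar a' : ℝ)
    (bbar b' : Fin p → ℝ) (ubar u' : Fin q → ℝ) (A : Finset (Fin p)) (B : Finset (Fin q)) : ℝ :=
  f (abar, A.piecewise bbar b', B.piecewise ubar u') -
    f (a', A.piecewise bbar b', B.piecewise ubar u')

lemma bshap_inl_eq_sum {p q : ℕ} (f : ℝ × (Fin p → ℝ) × (Fin q → ℝ) → ℝ) (abar a' : ℝ)
    (bbar b' : Fin p → ℝ) (ubar u' : Fin q → ℝ) :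
    BShap (unpack abar bbar ubar) (unpack a' b' u') (fun z => f (pack z)) (Sum.inl ()) =
      ∑ A : Finset (Fin p), ∑ B : Finset (Fin q), shapleyWeight (A.card + B.card) (p + 1 + q) *
        marginal f abar a' bbar b' ubar u' A B := by
  rw [← Fintype.sum_prod_type', BShap]
  symm
  refine Finset.sum_bij' (fun P _ => (∅ : Finset Unit).disjSum (P.fst.disjSum P.snd))
    (fun S _ => (S.toRight.toLeft, S.toRight.toRight)) ?_ ?_ ?_ ?_ ?_
  · intro P _
    simp [Finset.mem_powerset, Finset.subset_erase]
  · simp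
  · rintro ⟨A, B⟩ _
    simp only [Finset.toRight_disjSum, Finset.toLeft_disjSum]
  · intro S hS
    have hS' : Sum.inl () ∉ S := (Finset.subset_erase.mp (Finset.mem_powerset.mp hS)).2
    ext x
    rcases x with x | x | x <;> simp [hS']
  · rintro ⟨A, B⟩ _
    have hcard : Fintype.card (Unit ⊕ Fin p ⊕ Fin q) = p + 1 + q := by
      simp; omega
    rw [hcard]
    simp only [shapleyWeight, marginal, pack, unpack, Finset.card_disjSum, Finset.card_empty,
      zero_add, Finset.mem_insert, Finset.inl_mem_disjSum, Finset.inr_mem_disjSum, reduceCtorEq,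
      Finset.notMem_empty, true_or, false_or, if_true, if_false]
    rfl

/-- Averaging a function of the shared coordinates with Shapley weights does not depend on the
number of private coordinates. -/
lemma sum_sum_shapleyWeight_mul {p q : ℕ} (c : Finset (Fin p) → ℝ) :
    ∑ A : Finset (Fin p), ∑ B : Finset (Fin q), shapleyWeight (A.card + B.card) (p + 1 + q) * c A =
      ∑ A : Finset (Fin p), shapleyWeight A.card (p + 1) * c A := by
  refine Finset.sum_congr rfl fun A _ => ?_
  have hA : A.card < p + 1 := Nat.lt_succ_of_le (card_finset_fin_le A)
  rw [← Finset.sum_mul, ← sum_powerset_shapleyWeight hA (Finset.univ : Finset (Fin q))]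
  simp

/-- A pointwise inequality of first partial derivatives integrates to an inequality of increments. -/
lemma sub_le_sub_of_fderiv_le {E F : Type*} [NormedAddCommGroup E] [NormedSpace ℝ E]
    [NormedAddCommGroup F] [NormedSpace ℝ F] {f : ℝ × E → ℝ} {g : ℝ × F → ℝ}
    (hf : Differentiable ℝ f) (hg : Differentiable ℝ g) (x : E) (y : F)
    (h : ∀ a, fderiv ℝ g (a, y) (1, 0) ≤ fderiv ℝ f (a, x) (1, 0)) {a' a : ℝ} (ha : a' ≤ a) :
    g (a, y) - g (a', y) ≤ f (a, x) - f (a', x) := by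
  have hf' (t : ℝ) : HasDerivAt (fun t => f (t, x)) (fderiv ℝ f (t, x) (1, 0)) t :=
    (hf (t, x)).hasFDerivAt.comp_hasDerivAt t ((hasDerivAt_id t).prodMk (hasDerivAt_const t x))
  have hg' (t : ℝ) : HasDerivAt (fun t => g (t, y)) (fderiv ℝ g (t, y) (1, 0)) t :=
    (hg (t, y)).hasFDerivAt.comp_hasDerivAt t ((hasDerivAt_id t).prodMk (hasDerivAt_const t y))
  have hmono : Monotone fun t => f (t, x) - g (t, y) :=
    monotone_of_hasDerivAt_nonneg (fun t => (hf' t).sub (hg' t)) fun t => sub_nonneg.mpr (h t)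
  have := hmono ha
  simp only at this
  linarith

/-- Baseline Shapley preserves first-order monotonic dominance: if `f` dominates `g`
in the first coordinate at first order, then the Baseline Shapley attribution of the
first coordinate for `f` is at least that for `g`, whenever the explicands (resp.
baselines) share the first coordinate and the shared block of coordinates, and the
explicand's first coordinate is at least the baseline's. -/
theorem bshap_first_order_monotonic_dominance {p q r : ℕ}
    (f : ℝ × (Fin p → ℝ) × (Fin q → ℝ) → ℝ)
    (g : ℝ × (Fin p → ℝ) × (Fin r → ℝ) → ℝ)
    (hf : ContDiff ℝ (⊤ : ℕ∞) f) (hg : ContDiff ℝ (⊤ : ℕ∞) g)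
    (hdom : ∀ (a : ℝ) (b : Fin p → ℝ) (u : Fin q → ℝ) (w : Fin r → ℝ),
      fderiv ℝ g (a, b, w) (1, 0, 0) ≤ fderiv ℝ f (a, b, u) (1, 0, 0))
    (abar a' : ℝ) (bbar b' : Fin p → ℝ) (ubar u' : Fin q → ℝ) (wbar w' : Fin r → ℝ)
    (ha : a' ≤ abar) :
    BShap (unpack abar bbar wbar) (unpack a' b' w') (fun z => g (pack z)) (Sum.inl ()) ≤
      BShap (unpack abar bbar ubar) (unpack a' b' u') (fun z => f (pack z)) (Sum.inl ()) := by
  have hle (A : Finset (Fin p)) (B : Finset (Fin q)) (C : Finset (Fin r)) :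
      marginal g abar a' bbar b' wbar w' A C ≤ marginal f abar a' bbar b' ubar u' A B :=
    sub_le_sub_of_fderiv_le (hf.differentiable (by simp)) (hg.differentiable (by simp)) _ _
      (fun a => hdom a _ _ _) ha
  let c (A : Finset (Fin p)) : ℝ :=
    Finset.univ.inf' Finset.univ_nonempty (marginal f abar a' bbar b' ubar u' A)
  rw [bshap_inl_eq_sum, bshap_inl_eq_sum]
  calc
    _ ≤ ∑ A : Finset (Fin p), ∑ C : Finset (Fin r),
          shapleyWeight (A.card + C.card) (p + 1 + r) * c A := by
      gcongr with A _ C _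
      · exact shapleyWeight_nonneg _ _
      · exact Finset.le_inf' _ _ fun B _ => hle A B C
    _ = ∑ A : Finset (Fin p), ∑ B : Finset (Fin q),
          shapleyWeight (A.card + B.card) (p + 1 + q) * c A := by
      rw [sum_sum_shapleyWeight_mul, sum_sum_shapleyWeight_mul]
    _ ≤ _ := by
      gcongr with A _ B _
      · exact shapleyWeight_nonneg _ _
      · exact Finset.inf'_le _ (Finset.mem_univ B)
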